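/- Let Σ be a ranked alphabet and B be a strong bimonoid. The following three statements are equivalent: (1) if Σ is not trivial then B is right-distributive, and if Σ is branching then B is left-distributive; (2) for each weighted tree automaton A over Σ and B, the image of ⟦A⟧^run equals the image of ⟦A⟧^init; (3) for each weighted tree automaton A over Σ and B, ⟦A⟧^run = ⟦A⟧^init. -/

import Mathlib

/-! Strong bimonoids -/

structure StrongBimonoid (B : Type) where
  add : B → B → B
  mul : B → B → B
  zero : B
  one : B
  add_assoc : ∀ a b c, add (add a b) c = add a (add b c)
  add_comm : ∀ a b, add a b = add b a
  add_zero : ∀ a, add a zero = a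
  mul_assoc : ∀ a b c, mul (mul a b) c = mul a (mul b c)
  one_mul : ∀ a, mul one a = a
  mul_one : ∀ a, mul a one = a
  zero_mul : ∀ a, mul zero a = zero
  mul_zero : ∀ a, mul a zero = zero

namespace StrongBimonoid

variable {B : Type} (S : StrongBimonoid B)

/-- The additive commutative monoid underlying a strong bimonoid. -/
def acm : AddCommMonoid B where
  add := S.add
  zero := S.zero
  add_assoc := S.add_assoc
  zero_add := fun a => (S.add_comm S.zero a).trans (S.add_zero a)
  add_zero := S.add_zero
  add_comm := S.add_comm
  nsmul := fun n a => Nat.rec S.zero (fun _ ih => S.add ih a) n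
  nsmul_zero := fun _ => rfl
  nsmul_succ := fun _ _ => rfl

/-- Finite sum (w.r.t. `S.add`, `S.zero`) of `f` over a finite index set. -/
def fsum {ι : Type} (t : Finset ι) (f : ι → B) : B :=
  @Finset.sum ι B S.acm t f

/-- Ordered product `f 0 ⊗ f 1 ⊗ ⋯ ⊗ f (k-1)` (empty product is `S.one`). -/
def finProd : {k : ℕ} → (Fin k → B) → B
  | 0, _ => S.one
  | _ + 1, f => S.mul (f 0) (finProd (fun i => f i.succ))

def ZeroSumFree : Prop :=
  ∀ a b, S.add a b = S.zero → a = S.zero ∧ b = S.zero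

def StronglyZeroSumFree : Prop :=
  ∀ a b c, S.mul (S.add a b) c = S.zero ↔ (S.mul a c = S.zero ∧ S.mul b c = S.zero)

def BiStronglyZeroSumFree : Prop :=
  ∀ a b b' c, S.mul (S.mul a (S.add b b')) c = S.zero ↔
    (S.mul (S.mul a b) c = S.zero ∧ S.mul (S.mul a b') c = S.zero)

def ZeroDivisorFree : Prop :=
  ∀ a b, S.mul a b = S.zero ↔ (a = S.zero ∨ b = S.zero)

def Positive : Prop := S.ZeroSumFree ∧ S.ZeroDivisorFree

def RightDistributive : Prop :=
  ∀ a b c, S.mul (S.add a b) c = S.add (S.mul a c) (S.mul b c)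

def LeftDistributive : Prop :=
  ∀ a b c, S.mul a (S.add b c) = S.add (S.mul a b) (S.mul a c)

def ZeroRightDistributive : Prop :=
  ∀ a b c, (S.mul (S.add a b) c = S.zero ↔ S.add (S.mul a c) (S.mul b c) = S.zero)

def CommutativeMul : Prop := ∀ a b, S.mul a b = S.mul b a

end StrongBimonoid

/-! Weighted automata over words -/

section Word

variable {B : Type} {Γ : Type} {Q : Type}

/-- The product `μ(a₁)_{ρ₀,ρ₁} ⊗ ⋯ ⊗ μ(aₙ)_{ρₙ₋₁,ρₙ}` of the transition weights
along the run `ρ` on the word `w = a₁⋯aₙ`. -/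
def transProd (S : StrongBimonoid B) (μ : Γ → Q → Q → B) :
    (w : List Γ) → (Fin (w.length + 1) → Q) → B
  | [], _ => S.one
  | a :: w, ρ => S.mul (μ a (ρ 0) (ρ 1)) (transProd S μ w (fun i => ρ i.succ))

/-- Run semantics of the weighted automaton `(Q, I, μ, F)` over `Γ` and `S`. -/
def runSem (S : StrongBimonoid B) [Fintype Q] (I : Q → B) (μ : Γ → Q → Q → B)
    (F : Q → B) (w : List Γ) : B :=
  S.fsum Finset.univ (fun ρ : Fin (w.length + 1) → Q =>
    S.mul (S.mul (I (ρ 0)) (transProd S μ w ρ)) (F (ρ (Fin.last w.length))))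

/-- `hWord S μ w v` is the vector `v ⊗ μ(a₁) ⊗ ⋯ ⊗ μ(aₙ)` (left-associated
vector-matrix products) for `w = a₁⋯aₙ`. -/
def hWord (S : StrongBimonoid B) [Fintype Q] (μ : Γ → Q → Q → B) :
    List Γ → (Q → B) → (Q → B)
  | [], v => v
  | a :: w, v =>
      hWord S μ w (fun q => S.fsum Finset.univ (fun p => S.mul (v p) (μ a p q)))

/-- Initial algebra semantics of the weighted automaton `(Q, I, μ, F)`. -/
def initSem (S : StrongBimonoid B) [Fintype Q] (I : Q → B) (μ : Γ → Q → Q → B)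
    (F : Q → B) (w : List Γ) : B :=
  S.fsum Finset.univ (fun q => S.mul (hWord S μ w I q) (F q))

end Word

/-! Ranked alphabets, trees and weighted tree automata -/

/-- Trees over the ranked alphabet `(σ, rk)`: a node labelled `s` has exactly
`rk s` children. -/
inductive RTree (σ : Type) (rk : σ → ℕ) : Type where
  | node (s : σ) (ts : Fin (rk s) → RTree σ rk) : RTree σ rk

/-- The ranked alphabet is trivial if all symbols have rank 0. -/
def RankTrivial {σ : Type} (rk : σ → ℕ) : Prop := ∀ s, rk s = 0

/-- The ranked alphabet is branching if some symbol has rank ≥ 2. -/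
def RankBranching {σ : Type} (rk : σ → ℕ) : Prop := ∃ s, 2 ≤ rk s

/-- A run of an automaton with state set `Q` on a tree: an assignment of a
state to every position of the tree. -/
inductive TreeRun (σ : Type) (rk : σ → ℕ) (Q : Type) : RTree σ rk → Type where
  | node {s : σ} {ts : Fin (rk s) → RTree σ rk} (q : Q)
      (rs : (i : Fin (rk s)) → TreeRun σ rk Q (ts i)) :
      TreeRun σ rk Q (RTree.node s ts)

/-- The state assigned by a run to the root. -/
def TreeRun.root {σ : Type} {rk : σ → ℕ} {Q : Type} {t : RTree σ rk} :
    TreeRun σ rk Q t → Q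
  | .node q _ => q

def treeRunFintype {σ : Type} {rk : σ → ℕ} (Q : Type) [Fintype Q] :
    (t : RTree σ rk) → Fintype (TreeRun σ rk Q t)
  | RTree.node s ts =>
    letI : ∀ i, Fintype (TreeRun σ rk Q (ts i)) := fun i => treeRunFintype Q (ts i)
    Fintype.ofEquiv (Q × ((i : Fin (rk s)) → TreeRun σ rk Q (ts i)))
      { toFun := fun p => TreeRun.node p.1 p.2
        invFun := fun r => match r with | TreeRun.node q rs => (q, rs)
        left_inv := fun _ => rfl
        right_inv := fun r => match r with | TreeRun.node _ _ => rfl }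

instance {σ : Type} {rk : σ → ℕ} {Q : Type} [Fintype Q] (t : RTree σ rk) :
    Fintype (TreeRun σ rk Q t) := treeRunFintype Q t

/-- The weight of a run on a tree. -/
def treeWt {B : Type} {σ : Type} {rk : σ → ℕ} {Q : Type} (S : StrongBimonoid B)
    (δ : (s : σ) → (Fin (rk s) → Q) → Q → B) :
    (t : RTree σ rk) → TreeRun σ rk Q t → B
  | _, TreeRun.node (s := s) (ts := ts) q rs =>
      S.mul (S.finProd (fun i => treeWt S δ (ts i) (rs i)))
        (δ s (fun i => (rs i).root) q)

/-- Run semantics of the weighted tree automaton `(Q, δ, F)`. -/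
def treeRunSem {B : Type} {σ : Type} {rk : σ → ℕ} {Q : Type} (S : StrongBimonoid B)
    [Fintype Q] (δ : (s : σ) → (Fin (rk s) → Q) → Q → B) (F : Q → B)
    (t : RTree σ rk) : B :=
  S.fsum Finset.univ (fun ρ : TreeRun σ rk Q t => S.mul (treeWt S δ t ρ) (F ρ.root))

/-- The map `h_A : T_Σ → B^Q` of the initial algebra semantics. -/
def treeH {B : Type} {σ : Type} {rk : σ → ℕ} {Q : Type} (S : StrongBimonoid B)
    [Fintype Q] (δ : (s : σ) → (Fin (rk s) → Q) → Q → B) :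
    RTree σ rk → Q → B
  | RTree.node s ts => fun q =>
      S.fsum Finset.univ (fun qs : Fin (rk s) → Q =>
        S.mul (S.finProd (fun i => treeH S δ (ts i) (qs i))) (δ s qs q))

/-- Initial algebra semantics of the weighted tree automaton `(Q, δ, F)`. -/
def treeInitSem {B : Type} {σ : Type} {rk : σ → ℕ} {Q : Type} (S : StrongBimonoid B)
    [Fintype Q] (δ : (s : σ) → (Fin (rk s) → Q) → Q → B) (F : Q → B)
    (t : RTree σ rk) : B :=
  S.fsum Finset.univ (fun q => S.mul (treeH S δ t q) (F q))


namespace StrongBimonoid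

variable {B : Type} (S : StrongBimonoid B)

/-! Finite sums and ordered products -/

theorem fsum_congr {ι : Type} {t : Finset ι} {f g : ι → B} (h : ∀ i, f i = g i) :
    S.fsum t f = S.fsum t g := by
  rw [funext h]

theorem fsum_zero {ι : Type} (t : Finset ι) : S.fsum t (fun _ => S.zero) = S.zero :=
  letI := S.acm
  Finset.sum_const_zero (s := t) (M := B)

theorem fsum_of_isEmpty {ι : Type} [Fintype ι] [IsEmpty ι] (f : ι → B) :
    S.fsum Finset.univ f = S.zero :=
  letI := S.acm
  Fintype.sum_empty f

theorem exists_ne_zero_of_fsum_ne_zero {ι : Type} {t : Finset ι} {f : ι → B}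
    (h : S.fsum t f ≠ S.zero) : ∃ i, f i ≠ S.zero := by
  by_contra! hf
  exact h ((S.fsum_congr hf).trans (S.fsum_zero t))

theorem fsum_eq_single {ι : Type} [Fintype ι] {f : ι → B} (i : ι)
    (h : ∀ j, j ≠ i → f j = S.zero) : S.fsum Finset.univ f = f i :=
  letI := S.acm
  Fintype.sum_eq_single i h

theorem fsum_of_injective {ι κ : Type} [Fintype ι] [Fintype κ] {e : ι → κ}
    (he : Function.Injective e) {f : κ → B} (hf : ∀ j, f j ≠ S.zero → ∃ i, j = e i) :
    S.fsum Finset.univ f = S.fsum Finset.univ (fun i => f (e i)) := by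
  let := S.acm
  refine (Fintype.sum_of_injective e he _ _ (fun j hj => ?_) fun _ => rfl).symm
  by_contra h
  obtain ⟨i, rfl⟩ := hf j h
  exact hj ⟨i, rfl⟩

theorem fsum_equiv {ι κ : Type} [Fintype ι] [Fintype κ] (e : ι ≃ κ) (f : κ → B) :
    S.fsum Finset.univ f = S.fsum Finset.univ (fun i => f (e i)) :=
  S.fsum_of_injective e.injective fun j _ => ⟨e.symm j, by simp⟩

theorem fsum_prod {ι κ : Type} [Fintype ι] [Fintype κ] (f : ι × κ → B) :
    S.fsum Finset.univ f =
      S.fsum Finset.univ (fun i => S.fsum Finset.univ (fun j => f (i, j))) :=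
  letI := S.acm
  Fintype.sum_prod_type f

theorem fsum_comm {ι κ : Type} [Fintype ι] [Fintype κ] (f : ι → κ → B) :
    S.fsum Finset.univ (fun i => S.fsum Finset.univ (fun j => f i j)) =
      S.fsum Finset.univ (fun j => S.fsum Finset.univ (fun i => f i j)) :=
  letI := S.acm
  Finset.sum_comm

theorem fsum_bool (f : Bool → B) :
    S.fsum Finset.univ f = S.add (f true) (f false) :=
  letI := S.acm
  Fintype.sum_bool f

variable {S}

theorem fsum_mul {ι : Type} [Fintype ι] (h : S.RightDistributive ∨ Subsingleton ι)
    (f : ι → B) (c : B) :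
    S.mul (S.fsum Finset.univ f) c = S.fsum Finset.univ (fun i => S.mul (f i) c) := by
  rcases h with h | h
  · let := S.acm
    exact map_sum (⟨⟨fun b => S.mul b c, S.zero_mul c⟩, fun a b => h a b c⟩ : B →+ B) f _
  · cases isEmpty_or_nonempty ι with
    | inl _ => rw [S.fsum_of_isEmpty, S.fsum_of_isEmpty, S.zero_mul]
    | inr hι =>
      obtain ⟨i⟩ := hι
      rw [S.fsum_eq_single i (fun j hj => (hj (h.elim j i)).elim),
        S.fsum_eq_single i (fun j hj => (hj (h.elim j i)).elim)]

theorem mul_fsum {ι : Type} [Fintype ι] (h : S.LeftDistributive ∨ Subsingleton ι)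
    (f : ι → B) (c : B) :
    S.mul c (S.fsum Finset.univ f) = S.fsum Finset.univ (fun i => S.mul c (f i)) := by
  rcases h with h | h
  · let := S.acm
    exact map_sum (⟨⟨fun b => S.mul c b, S.mul_zero c⟩, fun a b => h c a b⟩ : B →+ B) f _
  · cases isEmpty_or_nonempty ι with
    | inl _ => rw [S.fsum_of_isEmpty, S.fsum_of_isEmpty, S.mul_zero]
    | inr hι =>
      obtain ⟨i⟩ := hι
      rw [S.fsum_eq_single i (fun j hj => (hj (h.elim j i)).elim),
        S.fsum_eq_single i (fun j hj => (hj (h.elim j i)).elim)]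

variable (S)

theorem ne_zero_of_mul_ne_zero {a b : B} (h : S.mul a b ≠ S.zero) :
    a ≠ S.zero ∧ b ≠ S.zero :=
  ⟨fun ha => h (by rw [ha, S.zero_mul]), fun hb => h (by rw [hb, S.mul_zero])⟩

theorem ne_zero_of_finProd_ne_zero {k : ℕ} {f : Fin k → B} (h : S.finProd f ≠ S.zero)
    (i : Fin k) : f i ≠ S.zero := by
  induction k with
  | zero => exact i.elim0
  | succ k ih =>
    have h' := S.ne_zero_of_mul_ne_zero h
    cases i using Fin.cases with
    | zero => exact h'.1
    | succ i => exact ih h'.2 i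

theorem finProd_eq_one {k : ℕ} {f : Fin k → B} (h : ∀ i, f i = S.one) :
    S.finProd f = S.one := by
  induction k with
  | zero => rfl
  | succ k ih => rw [finProd, h, ih fun i => h i.succ, S.one_mul]

theorem finProd_eq_first {k : ℕ} (hk : 1 ≤ k) {f : Fin k → B}
    (h : ∀ i, 1 ≤ i.val → f i = S.one) : S.finProd f = f ⟨0, hk⟩ := by
  obtain ⟨k, rfl⟩ := Nat.exists_eq_add_of_le' hk
  rw [finProd, S.finProd_eq_one fun i => h i.succ (by simp), S.mul_one]
  rfl

theorem finProd_eq_first_mul_second {k : ℕ} (hk : 2 ≤ k) {f : Fin k → B}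
    (h : ∀ i, 2 ≤ i.val → f i = S.one) :
    S.finProd f = S.mul (f ⟨0, by omega⟩) (f ⟨1, hk⟩) := by
  obtain ⟨k, rfl⟩ := Nat.exists_eq_add_of_le' (show 1 ≤ k by omega)
  rw [finProd, S.finProd_eq_first (by omega) fun i hi => h i.succ (by simpa using hi)]
  rfl

open Classical in
theorem finProd_ite {k : ℕ} (p : Fin k → Prop) (f : Fin k → B) :
    S.finProd (fun i => if p i then f i else S.zero) =
      if ∀ i, p i then S.finProd f else S.zero := by
  split_ifs with h
  · simp [h]
  · by_contra h'
    refine h fun i => ?_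
    by_contra hi
    exact S.ne_zero_of_finProd_ne_zero h' i (if_neg hi)

variable {S}

theorem finProd_fsum {k : ℕ} (hr : 1 ≤ k → S.RightDistributive)
    (hl : 2 ≤ k → S.LeftDistributive) {ι : Fin k → Type} [∀ i, Fintype (ι i)]
    (f : (i : Fin k) → ι i → B) :
    S.finProd (fun i => S.fsum Finset.univ (f i)) =
      S.fsum Finset.univ (fun g : (i : Fin k) → ι i => S.finProd (fun i => f i (g i))) := by
  induction k with
  | zero =>
    rw [S.fsum_eq_single (ι := (i : Fin 0) → ι i) fun i => i.elim0]
    · rfl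
    · exact fun g hg => (hg (Subsingleton.elim _ _)).elim
  | succ k ih =>
    have hl' : S.LeftDistributive ∨ Subsingleton ((i : Fin k) → ι i.succ) := by
      rcases Nat.eq_zero_or_pos k with rfl | hk
      · exact .inr inferInstance
      · exact .inl (hl (by omega))
    rw [finProd, ih (fun _ => hr (by omega)) (fun _ => hl (by omega)) fun i => f i.succ,
      fsum_mul (.inl (hr (by omega))), S.fsum_equiv (Fin.consEquiv ι), fsum_prod]
    refine S.fsum_congr fun x => ?_
    rw [mul_fsum hl']
    rfl

end StrongBimonoid

/-! Agreement of the two semantics under distributivity -/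

section Agreement

variable {B : Type} {σ : Type} {rk : σ → ℕ} {Q : Type}

/-- A run on `s(t₁,…,tₖ)` is a root state together with a run on each `tᵢ`. -/
def treeRunEquiv (Q : Type) (s : σ) (ts : Fin (rk s) → RTree σ rk) :
    (Q × ((i : Fin (rk s)) → TreeRun σ rk Q (ts i))) ≃ TreeRun σ rk Q (RTree.node s ts) where
  toFun p := TreeRun.node p.1 p.2
  invFun r := match r with | TreeRun.node q rs => (q, rs)
  left_inv _ := rfl
  right_inv r := match r with | TreeRun.node _ _ => rfl

theorem subsingleton_treeRun_children {s : σ} (hs : rk s = 0) (ts : Fin (rk s) → RTree σ rk) :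
    Subsingleton ((i : Fin (rk s)) → TreeRun σ rk Q (ts i)) :=
  ⟨fun _ _ => funext fun i => absurd i.isLt (by omega)⟩

variable (S : StrongBimonoid B) (δ : (s : σ) → (Fin (rk s) → Q) → Q → B)

theorem treeWt_node {s : σ} {ts : Fin (rk s) → RTree σ rk} (q : Q)
    (rs : (i : Fin (rk s)) → TreeRun σ rk Q (ts i)) :
    treeWt S δ (RTree.node s ts) (TreeRun.node q rs) =
      S.mul (S.finProd (fun i => treeWt S δ (ts i) (rs i)))
        (δ s (fun i => (rs i).root) q) := rfl

variable [Fintype Q]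

theorem treeH_node (s : σ) (ts : Fin (rk s) → RTree σ rk) (q : Q) :
    treeH S δ (RTree.node s ts) q = S.fsum Finset.univ (fun qs : Fin (rk s) → Q =>
      S.mul (S.finProd (fun i => treeH S δ (ts i) (qs i))) (δ s qs q)) := rfl

theorem fsum_treeRun_node (s : σ) (ts : Fin (rk s) → RTree σ rk)
    (G : TreeRun σ rk Q (RTree.node s ts) → B) :
    S.fsum Finset.univ G =
      S.fsum Finset.univ (fun q => S.fsum Finset.univ
        (fun rs : (i : Fin (rk s)) → TreeRun σ rk Q (ts i) => G (TreeRun.node q rs))) := by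
  rw [S.fsum_equiv (treeRunEquiv Q s ts), S.fsum_prod]
  rfl

open Classical in
theorem fsum_ite_root (s : σ) (ts : Fin (rk s) → RTree σ rk) (q : Q)
    (G : TreeRun σ rk Q (RTree.node s ts) → B) :
    S.fsum Finset.univ (fun ρ => if ρ.root = q then G ρ else S.zero) =
      S.fsum Finset.univ
        (fun rs : (i : Fin (rk s)) → TreeRun σ rk Q (ts i) => G (TreeRun.node q rs)) := by
  rw [fsum_treeRun_node, S.fsum_eq_single q]
  · simp [TreeRun.root]
  · intro q' hq'
    simp only [TreeRun.root, hq', if_false]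
    exact S.fsum_zero _

variable {S}

open Classical in
theorem treeH_eq_fsum_runs (hr : ¬ RankTrivial rk → S.RightDistributive)
    (hl : RankBranching rk → S.LeftDistributive) (t : RTree σ rk) (q : Q) :
    treeH S δ t q =
      S.fsum Finset.univ (fun ρ => if ρ.root = q then treeWt S δ t ρ else S.zero) := by
  induction t generalizing q with
  | node s ts ih =>
    have hr' : 1 ≤ rk s → S.RightDistributive := fun h => hr fun h' => by
      have := h' s
      omega
    have hr'' : S.RightDistributive ∨
        Subsingleton ((i : Fin (rk s)) → TreeRun σ rk Q (ts i)) := by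
      rcases Nat.eq_zero_or_pos (rk s) with hs | hs
      · exact .inr (subsingleton_treeRun_children hs ts)
      · exact .inl (hr' hs)
    rw [fsum_ite_root, treeH_node]
    simp only [ih]
    have key (qs : Fin (rk s) → Q) :
        S.mul (S.finProd fun i => S.fsum Finset.univ fun ρ : TreeRun σ rk Q (ts i) =>
          if ρ.root = qs i then treeWt S δ (ts i) ρ else S.zero) (δ s qs q) =
        S.fsum Finset.univ fun rs : (i : Fin (rk s)) → TreeRun σ rk Q (ts i) =>
          if ∀ i, (rs i).root = qs i
            then treeWt S δ (RTree.node s ts) (TreeRun.node q rs) else S.zero := by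
      rw [StrongBimonoid.finProd_fsum hr' fun h => hl ⟨s, h⟩, StrongBimonoid.fsum_mul hr'']
      refine S.fsum_congr fun rs => ?_
      rw [S.finProd_ite (fun i => (rs i).root = qs i)]
      split_ifs with h
      · rw [← funext h]
        rfl
      · exact S.zero_mul _
    rw [S.fsum_congr key, S.fsum_comm]
    refine S.fsum_congr fun rs => ?_
    rw [S.fsum_eq_single fun i => (rs i).root]
    · simp
    · intro qs hqs
      exact if_neg fun h => hqs (funext h).symm

theorem treeRunSem_eq_treeInitSem (hr : ¬ RankTrivial rk → S.RightDistributive)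
    (hl : RankBranching rk → S.LeftDistributive) (F : Q → B) :
    treeRunSem S δ F = treeInitSem S δ F := by
  classical
  funext t
  obtain ⟨s, ts⟩ := t
  have h : S.RightDistributive ∨
      Subsingleton ((i : Fin (rk s)) → TreeRun σ rk Q (ts i)) := by
    by_cases ht : RankTrivial rk
    · exact .inr (subsingleton_treeRun_children (ht s) ts)
    · exact .inl (hr ht)
  rw [treeRunSem, treeInitSem, fsum_treeRun_node]
  refine S.fsum_congr fun q => ?_
  rw [treeH_eq_fsum_runs δ hr hl, fsum_ite_root, StrongBimonoid.fsum_mul h]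
  rfl

end Agreement

/-! Supports -/

section Support

variable {B : Type} {σ : Type} {rk : σ → ℕ} {Q : Type} (S : StrongBimonoid B)
  (δ : (s : σ) → (Fin (rk s) → Q) → Q → B)

/-- The state `q` is reachable on a tree by transitions of nonzero weight. -/
def Reaches : RTree σ rk → Q → Prop
  | RTree.node s ts, q => ∃ qs, δ s qs q ≠ S.zero ∧ ∀ i, Reaches (ts i) (qs i)

theorem reaches_of_treeH_ne_zero [Fintype Q] (t : RTree σ rk) (q : Q)
    (h : treeH S δ t q ≠ S.zero) : Reaches S δ t q := by
  induction t generalizing q with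
  | node s ts ih =>
    obtain ⟨qs, hqs⟩ := S.exists_ne_zero_of_fsum_ne_zero h
    have hqs := S.ne_zero_of_mul_ne_zero hqs
    exact ⟨qs, hqs.2, fun i => ih i _ (S.ne_zero_of_finProd_ne_zero hqs.1 i)⟩

theorem reaches_of_treeWt_ne_zero {t : RTree σ rk} (ρ : TreeRun σ rk Q t)
    (h : treeWt S δ t ρ ≠ S.zero) : Reaches S δ t ρ.root := by
  induction ρ with
  | node q rs ih =>
    have h := S.ne_zero_of_mul_ne_zero h
    exact ⟨_, h.2, fun i => ih i (S.ne_zero_of_finProd_ne_zero h.1 i)⟩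

/-- If a single tree `t₀` can be accepted with nonzero weight, then equality of the images
forces both semantics to agree on `t₀`. -/
theorem treeRunSem_eq_of_range_eq [Fintype Q] (F : Q → B) (t₀ : RTree σ rk)
    (hF : ∀ t q, F q ≠ S.zero → Reaches S δ t q → t = t₀)
    (h : Set.range (treeRunSem S δ F) = Set.range (treeInitSem S δ F)) :
    treeRunSem S δ F t₀ = treeInitSem S δ F t₀ := by
  have hrun (t) (ht : t ≠ t₀) : treeRunSem S δ F t = S.zero := by
    by_contra hne
    obtain ⟨ρ, hρ⟩ := S.exists_ne_zero_of_fsum_ne_zero hne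
    have hρ := S.ne_zero_of_mul_ne_zero hρ
    exact ht (hF t _ hρ.2 (reaches_of_treeWt_ne_zero S δ ρ hρ.1))
  have hinit (t) (ht : t ≠ t₀) : treeInitSem S δ F t = S.zero := by
    by_contra hne
    obtain ⟨q, hq⟩ := S.exists_ne_zero_of_fsum_ne_zero hne
    have hq := S.ne_zero_of_mul_ne_zero hq
    exact ht (hF t _ hq.2 (reaches_of_treeH_ne_zero S δ t q hq.1))
  obtain ⟨t, ht⟩ := h ▸ Set.mem_range_self (f := treeRunSem S δ F) t₀
  obtain ⟨t', ht'⟩ := h ▸ Set.mem_range_self (f := treeInitSem S δ F) t₀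
  by_cases h₁ : t = t₀
  · rw [← ht, h₁]
  by_cases h₂ : t' = t₀
  · rw [← ht', h₂]
  rw [← ht, ← ht', hinit t h₁, hrun t' h₂]

end Support

/-! An automaton computing a sum and a product with a sum -/

/-- States of the separating automaton. -/
inductive SepState : Type
  | factor
  | summand (b : Bool)
  | unit
  | sum
  | prod
  deriving DecidableEq, Fintype

namespace SepState

instance : Nonempty SepState := ⟨unit⟩

/-- Argument states for reaching `sum`. -/
def sumArgs (n : ℕ) (b : Bool) (i : Fin n) : SepState :=
  if i.val = 0 then summand b else unit

/-- Argument states for reaching `prod`. -/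
def prodArgs (n : ℕ) (i : Fin n) : SepState :=
  if i.val = 0 then factor else if i.val = 1 then sum else unit

/-- The inner transitions: `sumArgs` leads to `sum`, `prodArgs` leads to `prod`. -/
def Rule {n : ℕ} (qs : Fin n → SepState) : SepState → Prop
  | sum => ∃ b, qs = sumArgs n b
  | prod => qs = prodArgs n
  | _ => False

/-- Weights of the states at leaves. -/
def leafWt {B : Type} (S : StrongBimonoid B) (a : B) (u : Bool → B) : SepState → B
  | factor => a
  | summand b => u b
  | unit => S.one
  | _ => S.zero

section

variable {B : Type} (S : StrongBimonoid B) {σ : Type} {rk : σ → ℕ} (α s₀ : σ)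
  (hα : rk α = 0) (a : B) (u : Bool → B)

open Classical in
/-- Transition weights of the separating automaton, with `α` as leaf symbol and `s₀` as
inner symbol. -/
noncomputable def trans (s : σ) (qs : Fin (rk s) → SepState) (q : SepState) : B :=
  if s = α then leafWt S a u q else if s = s₀ ∧ Rule qs q then S.one else S.zero

/-- The tree consisting of a single leaf. -/
def leaf : RTree σ rk := .node α fun i => absurd i.isLt (by omega)

/-- The run on the leaf with a given state. -/
def leafRun (q : SepState) : TreeRun σ rk SepState (leaf α hα) :=
  .node q fun i => absurd i.isLt (by omega)

/-- The tree `s₀(α,…,α)`. -/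
def sumTree : RTree σ rk := .node s₀ fun _ => leaf α hα

/-- A run on `s₀(α,…,α)` ending in `sum`. -/
def sumRun (b : Bool) : TreeRun σ rk SepState (sumTree α s₀ hα) :=
  .node sum fun i => leafRun α hα (sumArgs _ b i)

/-- The tree on which a state other than `prod` is reached. -/
def argTree : SepState → RTree σ rk
  | sum => sumTree α s₀ hα
  | _ => leaf α hα

/-- The run reaching a state other than `prod`, using summand `b`. -/
def argRun (b : Bool) : (q : SepState) → TreeRun σ rk SepState (argTree α s₀ hα q)
  | sum => sumRun α s₀ hα b
  | factor => leafRun α hα factor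
  | summand b' => leafRun α hα (summand b')
  | unit => leafRun α hα unit
  | prod => leafRun α hα prod

/-- The tree `s₀(α,s₀(α,…,α),α,…,α)`. -/
def prodTree : RTree σ rk := .node s₀ fun i => argTree α s₀ hα (prodArgs _ i)

/-- A run on `s₀(α,s₀(α,…,α),α,…,α)` ending in `prod`. -/
def prodRun (b : Bool) : TreeRun σ rk SepState (prodTree α s₀ hα) :=
  .node prod fun i => argRun α s₀ hα b (prodArgs _ i)

theorem trans_leaf (qs : Fin (rk α) → SepState) (q : SepState) :
    trans S α s₀ a u α qs q = leafWt S a u q := if_pos rfl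

variable {S α s₀ a u}

theorem rule_of_trans_ne_zero {s : σ} (hs : s ≠ α) {qs : Fin (rk s) → SepState} {q : SepState}
    (h : trans S α s₀ a u s qs q ≠ S.zero) : s = s₀ ∧ Rule qs q := by
  by_contra h'
  exact h (by rw [trans, if_neg hs, if_neg h'])

theorem trans_sum (hs : s₀ ≠ α) {qs : Fin (rk s₀) → SepState} {b : Bool}
    (h : qs = sumArgs _ b) : trans S α s₀ a u s₀ qs sum = S.one := by
  rw [trans, if_neg hs, if_pos ⟨rfl, b, h⟩]

theorem trans_prod (hs : s₀ ≠ α) {qs : Fin (rk s₀) → SepState} (h : qs = prodArgs _) :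
    trans S α s₀ a u s₀ qs prod = S.one := by
  rw [trans, if_neg hs, if_pos ⟨rfl, h⟩]

theorem sumArgs_injective {n : ℕ} (hn : 1 ≤ n) : Function.Injective (sumArgs n) := by
  intro b b' h
  simpa [sumArgs] using congrFun h ⟨0, hn⟩

theorem sumArgs_ne {n : ℕ} (b : Bool) (i : Fin n) :
    sumArgs n b i ≠ sum ∧ sumArgs n b i ≠ prod := by
  unfold sumArgs
  split_ifs <;> simp

theorem prodArgs_ne {n : ℕ} (i : Fin n) : prodArgs n i ≠ prod := by
  unfold prodArgs
  split_ifs <;> simp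

theorem prodArgs_eq_sum_iff {n : ℕ} (i : Fin n) : prodArgs n i = sum ↔ i.val = 1 := by
  unfold prodArgs
  split_ifs <;> simp_all

theorem argTree_eq_leaf {q : SepState} (hq : q ≠ sum) :
    argTree α s₀ hα q = leaf α hα := by
  cases q <;> first | rfl | exact (hq rfl).elim

/-! The only tree on which each state is reached -/

theorem eq_leaf_of_reaches {t : RTree σ rk} {q : SepState} (hq : q ≠ sum) (hq' : q ≠ prod)
    (h : Reaches S (trans S α s₀ a u) t q) : t = leaf α hα := by
  obtain ⟨s, ts⟩ := t
  obtain ⟨qs, hqs, -⟩ := h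
  by_cases hs : s = α
  · subst hs
    exact congrArg _ (funext fun i => absurd i.isLt (by omega))
  · have hR := (rule_of_trans_ne_zero hs hqs).2
    cases q <;> first | exact (hq rfl).elim | exact (hq' rfl).elim | exact hR.elim

theorem eq_sumTree_of_reaches {t : RTree σ rk}
    (h : Reaches S (trans S α s₀ a u) t sum) : t = sumTree α s₀ hα := by
  obtain ⟨s, ts⟩ := t
  obtain ⟨qs, hqs, hts⟩ := h
  by_cases hs : s = α
  · subst hs
    exact (hqs (trans_leaf S s s₀ a u qs sum)).elim
  · obtain ⟨rfl, b, rfl⟩ := rule_of_trans_ne_zero hs hqs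
    exact congrArg _ (funext fun i =>
      eq_leaf_of_reaches hα (sumArgs_ne b i).1 (sumArgs_ne b i).2 (hts i))

theorem eq_argTree_of_reaches {t : RTree σ rk} {q : SepState} (hq : q ≠ prod)
    (h : Reaches S (trans S α s₀ a u) t q) : t = argTree α s₀ hα q := by
  by_cases hq' : q = sum
  · subst hq'
    exact eq_sumTree_of_reaches hα h
  · rw [argTree_eq_leaf hα hq']
    exact eq_leaf_of_reaches hα hq' hq h

theorem eq_prodTree_of_reaches {t : RTree σ rk}
    (h : Reaches S (trans S α s₀ a u) t prod) : t = prodTree α s₀ hα := by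
  obtain ⟨s, ts⟩ := t
  obtain ⟨qs, hqs, hts⟩ := h
  by_cases hs : s = α
  · subst hs
    exact (hqs (trans_leaf S s s₀ a u qs prod)).elim
  · obtain ⟨rfl, rfl⟩ := rule_of_trans_ne_zero hs hqs
    exact congrArg _ (funext fun i => eq_argTree_of_reaches hα (prodArgs_ne i) (hts i))

/-! The initial algebra semantics -/

theorem treeH_leaf (q : SepState) :
    treeH S (trans S α s₀ a u) (leaf α hα) q = leafWt S a u q := by
  rw [leaf, treeH_node, S.fsum_eq_single fun i : Fin (rk α) => absurd i.isLt (by omega),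
    S.finProd_eq_one fun i => absurd i.isLt (by omega), S.one_mul, trans_leaf]
  exact fun qs hqs => (hqs (funext fun i => absurd i.isLt (by omega))).elim

theorem treeH_sumTree (hs₀ : 1 ≤ rk s₀) :
    treeH S (trans S α s₀ a u) (sumTree α s₀ hα) sum = S.fsum Finset.univ u := by
  have hne : s₀ ≠ α := by
    rintro rfl
    omega
  rw [sumTree, treeH_node, S.fsum_of_injective (sumArgs_injective hs₀)]
  · refine S.fsum_congr fun b => ?_
    rw [trans_sum hne rfl, S.mul_one, S.finProd_eq_first hs₀]
    · rw [treeH_leaf]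
      rfl
    · intro i hi
      rw [treeH_leaf, sumArgs, if_neg (by omega)]
      rfl
  · intro qs hqs
    exact (rule_of_trans_ne_zero hne (S.ne_zero_of_mul_ne_zero hqs).2).2

theorem treeH_prodTree (hs₀ : 2 ≤ rk s₀) :
    treeH S (trans S α s₀ a u) (prodTree α s₀ hα) prod =
      S.mul a (S.fsum Finset.univ u) := by
  have hne : s₀ ≠ α := by
    rintro rfl
    omega
  have hleaf (i : Fin (rk s₀)) (hi : i.val ≠ 1) :
      treeH S (trans S α s₀ a u) (argTree α s₀ hα (prodArgs _ i)) (prodArgs _ i) =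
        leafWt S a u (prodArgs _ i) := by
    rw [argTree_eq_leaf hα (mt (prodArgs_eq_sum_iff i).1 hi), treeH_leaf]
  rw [prodTree, treeH_node, S.fsum_eq_single (prodArgs _), trans_prod hne rfl, S.mul_one,
    S.finProd_eq_first_mul_second hs₀, hleaf _ (by simp),
    (prodArgs_eq_sum_iff ⟨1, hs₀⟩).2 rfl]
  · exact congrArg _ (treeH_sumTree hα (by omega))
  · intro i hi
    rw [hleaf i (by omega), prodArgs, if_neg (by omega), if_neg (by omega)]
    rfl
  · intro qs hqs
    by_contra h
    exact hqs (rule_of_trans_ne_zero hne (S.ne_zero_of_mul_ne_zero h).2).2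

/-! The run semantics -/

theorem eq_leafRun (ρ : TreeRun σ rk SepState (leaf α hα)) : ρ = leafRun α hα ρ.root := by
  obtain ⟨⟨q, rs⟩, rfl⟩ := (treeRunEquiv SepState α _).surjective ρ
  exact congrArg (TreeRun.node q) (funext fun i => absurd i.isLt (by omega))

theorem treeWt_leafRun (q : SepState) :
    treeWt S (trans S α s₀ a u) (leaf α hα) (leafRun α hα q) = leafWt S a u q := by
  refine (treeWt_node S _ _ _).trans ?_
  rw [S.finProd_eq_one fun i => absurd i.isLt (by omega), S.one_mul,
    trans_leaf]

theorem treeWt_sumRun (hs₀ : 1 ≤ rk s₀) (b : Bool) :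
    treeWt S (trans S α s₀ a u) (sumTree α s₀ hα) (sumRun α s₀ hα b) = u b := by
  have hne : s₀ ≠ α := by
    rintro rfl
    omega
  refine (treeWt_node S _ _ _).trans ?_
  rw [trans_sum (b := b) hne, S.mul_one, S.finProd_eq_first hs₀]
  · rw [treeWt_leafRun]
    rfl
  · intro i hi
    rw [treeWt_leafRun, sumArgs, if_neg (by omega)]
    rfl
  · rfl

theorem sumRun_injective (hs₀ : 1 ≤ rk s₀) :
    Function.Injective (sumRun (rk := rk) α s₀ hα) := by
  intro b b' h
  have h' := congrArg
    (fun ρ => (((treeRunEquiv SepState s₀ fun _ => leaf α hα).symm ρ).2 ⟨0, hs₀⟩).root) h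
  exact SepState.summand.inj h'

theorem exists_eq_sumRun (hne : s₀ ≠ α) (ρ : TreeRun σ rk SepState (sumTree α s₀ hα))
    (hρ : ρ.root = sum) (h : treeWt S (trans S α s₀ a u) _ ρ ≠ S.zero) :
    ∃ b, ρ = sumRun α s₀ hα b := by
  obtain ⟨⟨q, rs⟩, rfl⟩ := (treeRunEquiv SepState s₀ _).surjective ρ
  obtain rfl : q = sum := hρ
  obtain ⟨-, b, hb⟩ := rule_of_trans_ne_zero hne (S.ne_zero_of_mul_ne_zero h).2
  refine ⟨b, congrArg (TreeRun.node sum) (funext fun i => ?_)⟩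
  exact (eq_leafRun hα (rs i)).trans (congrArg _ (congrFun hb i))

theorem argRun_eq_argRun {q : SepState} (hq : q ≠ sum) (b b' : Bool) :
    argRun (rk := rk) α s₀ hα b q = argRun α s₀ hα b' q := by
  cases q <;> first | rfl | exact (hq rfl).elim

theorem exists_eq_argRun (hne : s₀ ≠ α) {q : SepState}
    (ρ : TreeRun σ rk SepState (argTree α s₀ hα q)) (hρ : ρ.root = q)
    (h : treeWt S (trans S α s₀ a u) _ ρ ≠ S.zero) : ∃ b, ρ = argRun α s₀ hα b q := by
  cases q
  case sum => exact exists_eq_sumRun hα hne ρ hρ h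
  all_goals exact ⟨true, (eq_leafRun hα ρ).trans (congrArg _ hρ)⟩

theorem treeWt_argRun {q : SepState} (hq : q ≠ sum) (b : Bool) :
    treeWt S (trans S α s₀ a u) _ (argRun α s₀ hα b q) = leafWt S a u q := by
  cases q <;> first | exact (hq rfl).elim | exact treeWt_leafRun hα _

theorem root_argRun (b : Bool) (q : SepState) :
    (argRun (rk := rk) α s₀ hα b q).root = q := by
  cases q <;> rfl

theorem treeWt_argRun_sum (hs₀ : 1 ≤ rk s₀) {q : SepState} (hq : q = sum) (b : Bool) :
    treeWt S (trans S α s₀ a u) _ (argRun α s₀ hα b q) = u b := by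
  subst hq
  exact treeWt_sumRun hα hs₀ b

theorem argRun_injective (hs₀ : 1 ≤ rk s₀) {q : SepState} (hq : q = sum) :
    Function.Injective (argRun (rk := rk) α s₀ hα · q) := by
  subst hq
  exact sumRun_injective hα hs₀

theorem treeWt_prodRun (hs₀ : 2 ≤ rk s₀) (b : Bool) :
    treeWt S (trans S α s₀ a u) (prodTree α s₀ hα) (prodRun α s₀ hα b) = S.mul a (u b) := by
  have hne : s₀ ≠ α := by
    rintro rfl
    omega
  have hleaf (i : Fin (rk s₀)) (hi : i.val ≠ 1) :=
    treeWt_argRun (S := S) (s₀ := s₀) (a := a) (u := u) hα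
      (mt (prodArgs_eq_sum_iff i).1 hi) b
  refine (treeWt_node S _ _ _).trans ?_
  rw [trans_prod hne,
    S.mul_one, S.finProd_eq_first_mul_second hs₀, hleaf _ (by simp),
    treeWt_argRun_sum hα (by omega) ((prodArgs_eq_sum_iff ⟨1, hs₀⟩).2 rfl)]
  · rfl
  · intro i hi
    rw [hleaf i (by omega), prodArgs, if_neg (by omega), if_neg (by omega)]
    rfl
  · exact funext fun i => root_argRun hα b _

theorem prodRun_injective (hs₀ : 2 ≤ rk s₀) :
    Function.Injective (prodRun (rk := rk) α s₀ hα) := by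
  intro b b' h
  have h' := congrArg (fun ρ => ((treeRunEquiv SepState s₀
    fun i => argTree α s₀ hα (prodArgs _ i)).symm ρ).2 ⟨1, hs₀⟩) h
  exact argRun_injective hα (by omega) ((prodArgs_eq_sum_iff ⟨1, hs₀⟩).2 rfl) h'

theorem exists_eq_prodRun (hs₀ : 2 ≤ rk s₀)
    (ρ : TreeRun σ rk SepState (prodTree α s₀ hα))
    (hρ : ρ.root = prod) (h : treeWt S (trans S α s₀ a u) _ ρ ≠ S.zero) :
    ∃ b, ρ = prodRun α s₀ hα b := by
  have hne : s₀ ≠ α := by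
    rintro rfl
    omega
  obtain ⟨⟨q, rs⟩, rfl⟩ := (treeRunEquiv SepState s₀ _).surjective ρ
  obtain rfl : q = prod := hρ
  have h := S.ne_zero_of_mul_ne_zero h
  have hroot : (fun i => (rs i).root) = prodArgs _ := (rule_of_trans_ne_zero hne h.2).2
  choose b hb using fun i => exists_eq_argRun hα hne (rs i) (congrFun hroot i)
    (S.ne_zero_of_finProd_ne_zero h.1 i)
  refine ⟨b ⟨1, hs₀⟩, congrArg (TreeRun.node prod) (funext fun i => ?_)⟩
  by_cases hi : i.val = 1
  · obtain rfl : i = ⟨1, hs₀⟩ := Fin.ext hi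
    exact hb _
  · exact (hb i).trans (argRun_eq_argRun hα (mt (prodArgs_eq_sum_iff i).1 hi) _ _)

/-- Final weights concentrated on one state. -/
def final (S : StrongBimonoid B) (q₀ : SepState) (c : B) (q : SepState) : B :=
  if q = q₀ then c else S.zero

theorem eq_of_final_ne_zero {q₀ q : SepState} {c : B} (h : final S q₀ c q ≠ S.zero) :
    q = q₀ := by
  by_contra h'
  exact h (if_neg h')

theorem final_self (q₀ : SepState) (c : B) : final S q₀ c q₀ = c := if_pos rfl

theorem treeInitSem_final (q₀ : SepState) (c : B) (t : RTree σ rk) :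
    treeInitSem S (trans S α s₀ a u) (final S q₀ c) t =
      S.mul (treeH S (trans S α s₀ a u) t q₀) c := by
  rw [treeInitSem, S.fsum_eq_single q₀, final_self]
  intro q hq
  rw [final, if_neg hq, S.mul_zero]

theorem treeRunSem_sumTree (hs₀ : 1 ≤ rk s₀) (c : B) :
    treeRunSem S (trans S α s₀ a u) (final S sum c) (sumTree α s₀ hα) =
      S.fsum Finset.univ fun b => S.mul (u b) c := by
  have hne : s₀ ≠ α := by
    rintro rfl
    omega
  rw [treeRunSem, S.fsum_of_injective (sumRun_injective hα hs₀)]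
  · simp only [treeWt_sumRun hα hs₀]
    rfl
  · intro ρ hρ
    have hρ := S.ne_zero_of_mul_ne_zero hρ
    exact exists_eq_sumRun hα hne ρ (eq_of_final_ne_zero hρ.2) hρ.1

theorem treeRunSem_prodTree (hs₀ : 2 ≤ rk s₀) (c : B) :
    treeRunSem S (trans S α s₀ a u) (final S prod c) (prodTree α s₀ hα) =
      S.fsum Finset.univ fun b => S.mul (S.mul a (u b)) c := by
  rw [treeRunSem, S.fsum_of_injective (prodRun_injective hα hs₀)]
  · simp only [treeWt_prodRun hα hs₀]
    rfl
  · intro ρ hρ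
    have hρ := S.ne_zero_of_mul_ne_zero hρ
    exact exists_eq_prodRun hα hs₀ ρ (eq_of_final_ne_zero hρ.2) hρ.1

end

end SepState

section Separation

open SepState

variable {B : Type} {S : StrongBimonoid B} {σ : Type} {rk : σ → ℕ}

theorem rightDistributive_of_range_eq {α s₀ : σ} (hα : rk α = 0) (hs₀ : 1 ≤ rk s₀)
    (h : ∀ (δ : (s : σ) → (Fin (rk s) → SepState) → SepState → B) (F : SepState → B),
      Set.range (treeRunSem S δ F) = Set.range (treeInitSem S δ F)) :
    S.RightDistributive := by
  intro a b c
  have key := treeRunSem_eq_of_range_eq S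
    (trans S α s₀ S.zero fun i => if i then a else b) (final S sum c) (sumTree α s₀ hα)
    (fun t q hq ht => by
      obtain rfl := eq_of_final_ne_zero hq
      exact eq_sumTree_of_reaches hα ht) (h _ _)
  rw [treeRunSem_sumTree hα hs₀, treeInitSem_final, treeH_sumTree hα hs₀, S.fsum_bool,
    S.fsum_bool] at key
  exact key.symm

theorem leftDistributive_of_range_eq {α s₀ : σ} (hα : rk α = 0) (hs₀ : 2 ≤ rk s₀)
    (h : ∀ (δ : (s : σ) → (Fin (rk s) → SepState) → SepState → B) (F : SepState → B),
      Set.range (treeRunSem S δ F) = Set.range (treeInitSem S δ F)) :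
    S.LeftDistributive := by
  intro a b c
  have key := treeRunSem_eq_of_range_eq S
    (trans S α s₀ a fun i => if i then b else c) (final S prod S.one) (prodTree α s₀ hα)
    (fun t q hq ht => by
      obtain rfl := eq_of_final_ne_zero hq
      exact eq_prodTree_of_reaches hα ht) (h _ _)
  rw [treeRunSem_prodTree hα hs₀, treeInitSem_final, treeH_prodTree hα hs₀, S.fsum_bool,
    S.fsum_bool, S.mul_one, S.mul_one, S.mul_one] at key
  exact key.symm

end Separation

theorem stmt18 {B : Type} (S : StrongBimonoid B)
    (σt : Type) [Fintype σt] [Nonempty σt] (rk : σt → ℕ) (h0 : ∃ s, rk s = 0) :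
    (((¬ RankTrivial rk → S.RightDistributive) ∧
        (RankBranching rk → S.LeftDistributive)) ↔
      (∀ (Q : Type) [Fintype Q] [Nonempty Q] (δ : (s : σt) → (Fin (rk s) → Q) → Q → B) (F : Q → B),
        Set.range (treeRunSem S δ F) = Set.range (treeInitSem S δ F))) ∧
    ((∀ (Q : Type) [Fintype Q] [Nonempty Q] (δ : (s : σt) → (Fin (rk s) → Q) → Q → B) (F : Q → B),
        Set.range (treeRunSem S δ F) = Set.range (treeInitSem S δ F)) ↔
      (∀ (Q : Type) [Fintype Q] [Nonempty Q] (δ : (s : σt) → (Fin (rk s) → Q) → Q → B) (F : Q → B),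
        treeRunSem S δ F = treeInitSem S δ F)) := by
  obtain ⟨α, hα⟩ := h0
  have agree (h : (¬ RankTrivial rk → S.RightDistributive) ∧
      (RankBranching rk → S.LeftDistributive)) (Q : Type) [Fintype Q] [Nonempty Q]
      (δ : (s : σt) → (Fin (rk s) → Q) → Q → B) (F : Q → B) :
      treeRunSem S δ F = treeInitSem S δ F := treeRunSem_eq_treeInitSem δ h.1 h.2 F
  have separate (h : ∀ (Q : Type) [Fintype Q] [Nonempty Q]
      (δ : (s : σt) → (Fin (rk s) → Q) → Q → B) (F : Q → B),
      Set.range (treeRunSem S δ F) = Set.range (treeInitSem S δ F)) :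
      (¬ RankTrivial rk → S.RightDistributive) ∧
        (RankBranching rk → S.LeftDistributive) := by
    refine ⟨fun ht => ?_, fun ⟨s₀, hs₀⟩ => leftDistributive_of_range_eq hα hs₀ (h SepState)⟩
    obtain ⟨s₀, hs₀⟩ := not_forall.1 ht
    exact rightDistributive_of_range_eq hα (Nat.one_le_iff_ne_zero.2 hs₀) (h SepState)
  refine ⟨⟨fun h Q _ _ δ F => ?_, separate⟩,
    fun h Q _ _ δ F => agree (separate h) Q δ F, fun h Q _ _ δ F => ?_⟩
  · rw [agree h Q δ F]
  · rw [h Q δ F]
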